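/- arXiv:2211.06602 — 2 statements merged into one kernel-verified Lean document; each statement's English description precedes it below -/
import Mathlib

section
/- The Lebesgue integral over ℝ of the complex-valued function x ↦ (1 − 3x²)/((x−i)⁴(x+i)³) equals πi/8. -/
open Real Complex MeasureTheory

lemma ofReal_sub_I_ne_zero (x : ℝ) : (x : ℂ) - I ≠ 0 := fun h => by
  simpa using congrArg Complex.im h

lemma ofReal_add_I_ne_zero (x : ℝ) : (x : ℂ) + I ≠ 0 := fun h => by
  simpa using congrArg Complex.im h

lemma sq_norm_ofReal_sub_I (x : ℝ) : ‖(x : ℂ) - I‖ ^ 2 = 1 + x ^ 2 := by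
  rw [Complex.sq_norm, Complex.normSq_apply]
  simp
  ring

lemma norm_ofReal_add_I (x : ℝ) : ‖(x : ℂ) + I‖ = ‖(x : ℂ) - I‖ := by
  rw [← Complex.norm_conj]
  simp [sub_eq_add_neg]

lemma integrable_phi1_a :
    Integrable fun x : ℝ =>
      ((1 - 3 * (x : ℂ) ^ 2)) / (((x : ℂ) - I) ^ 4 * ((x : ℂ) + I) ^ 3) := by
  refine (integrable_inv_one_add_sq.const_mul 3).mono' ?_ (.of_forall fun x => ?_)
  · refine (Continuous.div (by fun_prop) (by fun_prop) fun x => ?_).aestronglyMeasurable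
    exact mul_ne_zero (pow_ne_zero _ (ofReal_sub_I_ne_zero x))
      (pow_ne_zero _ (ofReal_add_I_ne_zero x))
  · have hnum : ‖(1 - 3 * (x : ℂ) ^ 2)‖ ≤ 3 * (1 + x ^ 2) := by
      have h : (1 - 3 * (x : ℂ) ^ 2) = ((1 - 3 * x ^ 2 : ℝ) : ℂ) := by push_cast; rfl
      rw [h, Complex.norm_real, Real.norm_eq_abs, abs_le]
      constructor <;> nlinarith [sq_nonneg x]
    have hsq := sq_norm_ofReal_sub_I x
    rw [norm_div, norm_mul, norm_pow, norm_pow, norm_ofReal_add_I]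
    set n := ‖(x : ℂ) - I‖
    have hn : 1 ≤ n := by nlinarith [sq_nonneg x, norm_nonneg ((x : ℂ) - I)]
    rw [← hsq] at hnum ⊢
    have hn0 : 0 < n := by linarith
    calc _ ≤ 3 * n ^ 2 / (n ^ 4 * n ^ 3) := by gcongr
      _ = 3 * (n ^ 5)⁻¹ := by field_simp
      _ ≤ 3 * (n ^ 2)⁻¹ := by
        gcongr
        norm_num

lemma hasDerivAt_phi1_a_primitive (x : ℝ) :
    HasDerivAt
      (fun x : ℝ => -I / 6 * (((x : ℂ) - I)⁻¹) ^ 3 - 1 / 8 * (((x : ℂ) + I)⁻¹) ^ 2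
        + I / 8 * ((x : ℂ) + I)⁻¹ + I / 8 * (Real.arctan x : ℂ))
      (((1 - 3 * (x : ℂ) ^ 2)) / (((x : ℂ) - I) ^ 4 * ((x : ℂ) + I) ^ 3)) x := by
  have hu := ofReal_sub_I_ne_zero x
  have hv := ofReal_add_I_ne_zero x
  have hid : HasDerivAt (fun x : ℝ => (x : ℂ)) 1 x := by
    simpa using (hasDerivAt_id x).ofReal_comp
  have hdu := (hid.sub_const I).fun_inv hu
  have hdv := (hid.add_const I).fun_inv hv
  have hat := (hasDerivAt_arctan' x).ofReal_comp
  refine ((((hdu.fun_pow 3).const_mul (-I / 6)).sub ((hdv.fun_pow 2).const_mul (1 / 8))).add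
    (hdv.const_mul (I / 8)) |>.add (hat.const_mul (I / 8))).congr_deriv ?_
  have hfac : (1 + (x : ℂ) ^ 2) = ((x : ℂ) - I) * ((x : ℂ) + I) := by
    linear_combination I_sq
  push_cast
  rw [hfac]
  field_simp
  ring_nf
  simp only [show I ^ 3 = -I by simp [pow_succ], show I ^ 4 = 1 by simp [pow_succ],
    show I ^ 5 = I by simp [pow_succ], show I ^ 6 = -1 by simp [pow_succ], I_sq]
  ring

lemma tendsto_phi1_a_primitive {l : Filter ℝ} {a : ℝ}
    (hl : Filter.Tendsto (fun x : ℝ => (x : ℂ)) l (Bornology.cobounded ℂ))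
    (ha : Filter.Tendsto Real.arctan l (nhds a)) :
    Filter.Tendsto
      (fun x : ℝ => -I / 6 * (((x : ℂ) - I)⁻¹) ^ 3 - 1 / 8 * (((x : ℂ) + I)⁻¹) ^ 2
        + I / 8 * ((x : ℂ) + I)⁻¹ + I / 8 * (Real.arctan x : ℂ)) l (nhds (I / 8 * (a : ℂ))) := by
  have hv : Filter.Tendsto (fun x : ℝ => ((x : ℂ) + I)⁻¹) l (nhds 0) :=
    Filter.tendsto_inv₀_cobounded.comp ((tendsto_add_const_cobounded I).comp hl)
  have hu : Filter.Tendsto (fun x : ℝ => ((x : ℂ) - I)⁻¹) l (nhds 0) :=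
    Filter.tendsto_inv₀_cobounded.comp ((tendsto_sub_const_cobounded I).comp hl)
  have hat : Filter.Tendsto (fun x : ℝ => (Real.arctan x : ℂ)) l (nhds (a : ℂ)) :=
    (Complex.continuous_ofReal.tendsto a).comp ha
  have h := ((((hu.pow 3).const_mul (-I / 6)).sub ((hv.pow 2).const_mul (1 / 8))).add
    (hv.const_mul (I / 8))).add (hat.const_mul (I / 8))
  convert h using 2
  ring

theorem integral_phi1_a :
    ∫ x : ℝ, ((1 - 3 * (x : ℂ) ^ 2)) / (((x : ℂ) - I) ^ 4 * ((x : ℂ) + I) ^ 3) = (π : ℂ) * I / 8 := by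
  rw [integral_of_hasDerivAt_of_tendsto hasDerivAt_phi1_a_primitive integrable_phi1_a
    (tendsto_phi1_a_primitive (RCLike.tendsto_ofReal_atBot_cobounded ℂ)
      (tendsto_nhds_of_tendsto_nhdsWithin tendsto_arctan_atBot))
    (tendsto_phi1_a_primitive (RCLike.tendsto_ofReal_atTop_cobounded ℂ)
      (tendsto_nhds_of_tendsto_nhdsWithin tendsto_arctan_atTop))]
  push_cast
  ring
end

section
/- The Lebesgue integral over ℝ of the complex-valued function x ↦ (5x² − 1)/((x−i)⁶(x+i)⁴) equals 9π/64. -/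
open Real Complex MeasureTheory

lemma integrable_inv_one_add_sq_pow (n : ℕ) :
    Integrable fun x : ℝ ↦ ((1 + x ^ 2) ^ (n + 1))⁻¹ := by
  refine integrable_inv_one_add_sq.mono' (by fun_prop) (.of_forall fun x ↦ ?_)
  have h : 1 ≤ 1 + x ^ 2 := by nlinarith
  rw [Real.norm_of_nonneg (by positivity)]
  gcongr
  exact le_self_pow₀ h (by simp)

lemma norm_div_one_add_sq_pow_le (n : ℕ) (x : ℝ) :
    ‖x / (1 + x ^ 2) ^ (n + 1)‖ ≤ |x|⁻¹ := by
  rcases eq_or_ne x 0 with rfl | hx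
  · simp
  have h : 1 ≤ 1 + x ^ 2 := by nlinarith
  have hx' : 0 < |x| := abs_pos.mpr hx
  rw [norm_div, Real.norm_of_nonneg (by positivity : 0 ≤ (1 + x ^ 2) ^ (n + 1)),
    Real.norm_eq_abs, div_le_iff₀ (by positivity), inv_mul_eq_div, le_div_iff₀ hx']
  calc |x| * |x| ≤ 1 + x ^ 2 := by rw [abs_mul_abs_self]; nlinarith
    _ ≤ (1 + x ^ 2) ^ (n + 1) := le_self_pow₀ h (by simp)

lemma hasDerivAt_div_one_add_sq_pow (n : ℕ) (x : ℝ) :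
    HasDerivAt (fun x : ℝ ↦ x / (1 + x ^ 2) ^ (n + 1))
      ((2 * (n : ℝ) + 2) * ((1 + x ^ 2) ^ (n + 2))⁻¹ - (2 * (n : ℝ) + 1) * ((1 + x ^ 2) ^ (n + 1))⁻¹) x := by
  have h : 1 + x ^ 2 ≠ 0 := by positivity
  refine ((hasDerivAt_id' x).fun_div ((((hasDerivAt_id' x).fun_pow 2).const_add 1).fun_pow (n + 1))
    (pow_ne_zero _ h)).congr_deriv ?_
  rw [Nat.add_sub_cancel]
  field_simp
  push_cast
  ring

/-- The reduction formula for `∫ (1 + x ^ 2)⁻ⁿ` over the real line. -/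
lemma integral_inv_one_add_sq_pow_succ (n : ℕ) :
    (∫ x : ℝ, ((1 + x ^ 2) ^ (n + 2))⁻¹) =
      (2 * (n : ℝ) + 1) / (2 * (n : ℝ) + 2) * ∫ x : ℝ, ((1 + x ^ 2) ^ (n + 1))⁻¹ := by
  have hi : Integrable fun x : ℝ ↦ (2 * (n : ℝ) + 2) * ((1 + x ^ 2) ^ (n + 2))⁻¹ :=
    (integrable_inv_one_add_sq_pow (n + 1)).const_mul _
  have hj := (integrable_inv_one_add_sq_pow n).const_mul (2 * n + 1 : ℝ)
  have key := integral_of_hasDerivAt_of_tendsto (hasDerivAt_div_one_add_sq_pow n) (hi.sub hj)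
    (squeeze_zero_norm (norm_div_one_add_sq_pow_le n)
      (tendsto_inv_atTop_zero.comp Filter.tendsto_abs_atBot_atTop))
    (squeeze_zero_norm (norm_div_one_add_sq_pow_le n)
      (tendsto_inv_atTop_zero.comp Filter.tendsto_abs_atTop_atTop))
  rw [integral_sub hi hj, integral_const_mul, integral_const_mul] at key
  have h : (2 * n + 2 : ℝ) ≠ 0 := by positivity
  rw [div_mul_eq_mul_div, eq_div_iff h]
  linear_combination key

lemma integral_even_part :
    ∫ x : ℝ, (5 * x ^ 2 - 1) * (x ^ 2 - 1) / (1 + x ^ 2) ^ 6 = 9 * π / 64 := by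
  have h (x : ℝ) : (5 * x ^ 2 - 1) * (x ^ 2 - 1) / (1 + x ^ 2) ^ 6 =
      5 * ((1 + x ^ 2) ^ 4)⁻¹ - 16 * ((1 + x ^ 2) ^ 5)⁻¹ + 12 * ((1 + x ^ 2) ^ 6)⁻¹ := by
    field_simp
    ring
  have h4 : Integrable fun x : ℝ ↦ 5 * ((1 + x ^ 2) ^ 4)⁻¹ :=
    (integrable_inv_one_add_sq_pow 3).const_mul 5
  have h5 : Integrable fun x : ℝ ↦ 16 * ((1 + x ^ 2) ^ 5)⁻¹ :=
    (integrable_inv_one_add_sq_pow 4).const_mul 16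
  have h6 : Integrable fun x : ℝ ↦ 12 * ((1 + x ^ 2) ^ 6)⁻¹ :=
    (integrable_inv_one_add_sq_pow 5).const_mul 12
  simp_rw [h]
  rw [integral_add (by exact h4.sub h5) h6, integral_sub h4 h5]
  simp only [integral_const_mul, integral_inv_one_add_sq_pow_succ, zero_add, pow_one,
    integral_univ_inv_one_add_sq]
  norm_num
  ring

lemma integrable_even_part :
    Integrable fun x : ℝ ↦ (5 * x ^ 2 - 1) * (x ^ 2 - 1) / (1 + x ^ 2) ^ 6 :=
  .of_integral_ne_zero (by rw [integral_even_part]; positivity)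

lemma integrable_odd_part :
    Integrable fun x : ℝ ↦ 2 * x * (5 * x ^ 2 - 1) / (1 + x ^ 2) ^ 6 := by
  refine ((integrable_inv_one_add_sq_pow 3).const_mul 10).mono'
    (Measurable.aestronglyMeasurable (by fun_prop)) (.of_forall fun x ↦ ?_)
  rw [norm_div, Real.norm_of_nonneg (by positivity : 0 ≤ (1 + x ^ 2) ^ 6),
    div_le_iff₀ (by positivity), norm_mul, norm_mul]
  have h1 : ‖(2 : ℝ)‖ * ‖x‖ ≤ 2 * (1 + x ^ 2) := by
    rw [Real.norm_two, Real.norm_eq_abs]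
    nlinarith [sq_abs x, sq_nonneg (|x| - 1)]
  have h2 : ‖5 * x ^ 2 - 1‖ ≤ 5 * (1 + x ^ 2) := by
    rw [Real.norm_eq_abs, abs_le]
    constructor <;> nlinarith
  calc _ ≤ 2 * (1 + x ^ 2) * (5 * (1 + x ^ 2)) := by gcongr
    _ = _ := by field_simp; ring

lemma integral_odd_part :
    ∫ x : ℝ, 2 * x * (5 * x ^ 2 - 1) / (1 + x ^ 2) ^ 6 = 0 := by
  have h := integral_neg_eq_self (fun x : ℝ ↦ 2 * x * (5 * x ^ 2 - 1) / (1 + x ^ 2) ^ 6) volume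
  simp only [even_two.neg_pow, mul_neg, neg_mul, neg_div, integral_neg] at h
  linarith

theorem integral_phi3_d :
    ∫ x : ℝ, ((5 * (x : ℂ) ^ 2 - 1)) / (((x : ℂ) - I) ^ 6 * ((x : ℂ) + I) ^ 4) = 9 * (π : ℂ) / 64 := by
  have h (x : ℝ) : ((5 * (x : ℂ) ^ 2 - 1)) / (((x : ℂ) - I) ^ 6 * ((x : ℂ) + I) ^ 4) =
      (((5 * x ^ 2 - 1) * (x ^ 2 - 1) / (1 + x ^ 2) ^ 6 : ℝ) : ℂ) +
        ((2 * x * (5 * x ^ 2 - 1) / (1 + x ^ 2) ^ 6 : ℝ) : ℂ) * I := by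
    have hsub : (x : ℂ) - I ≠ 0 := fun h ↦ by simpa using congrArg Complex.im h
    have hadd : (x : ℂ) + I ≠ 0 := fun h ↦ by simpa using congrArg Complex.im h
    have hmul : 1 + (x : ℂ) ^ 2 = (x - I) * (x + I) := by linear_combination I_sq
    have hsq : ((x : ℂ) + I) ^ 2 = x ^ 2 - 1 + 2 * x * I := by linear_combination I_sq
    push_cast
    rw [hmul, div_mul_eq_mul_div, ← add_div, div_eq_div_iff (by positivity) (by positivity)]
    linear_combination (5 * (x : ℂ) ^ 2 - 1) * (x - I) ^ 6 * (x + I) ^ 4 * hsq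
  simp_rw [h]
  rw [integral_add (by exact integrable_even_part.ofReal)
      (by exact integrable_odd_part.ofReal.mul_const I),
    integral_mul_const, integral_complex_ofReal, integral_complex_ofReal, integral_even_part,
    integral_odd_part]
  simp
end
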